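/- For every N ∈ ℕ*, every ε > 0 and every μ⁰_N ∈ P_N(Ω), the functional J_ε(Q) = ∫_Γ L dQ + ∫₀^T F_ε(e_t#Q) dt + G(Q) is lower semi-continuous on P(Γ) for the narrow topology, and the infimum in the discretized problem (M_{N, μ⁰_N, ε}): inf { J_ε(Q) : Q ∈ P_N(Γ), e₀#Q = μ⁰_N } is attained. -/

import Mathlib

open MeasureTheory Filter Topology Set
open scoped ENNReal NNReal

noncomputable section

abbrev Euc (d : ℕ) : Type := EuclideanSpace ℝ (Fin d)

abbrev Traj (d : ℕ) (T : ℝ) : Type := C(Set.Icc (0:ℝ) T, Euc d)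

instance (d : ℕ) (T : ℝ) : MeasurableSpace (Traj d T) := borel _
instance (d : ℕ) (T : ℝ) : BorelSpace (Traj d T) := ⟨rfl⟩

/-- evaluation of a trajectory at time `t ∈ ℝ` (projected onto `[0,T]`). -/
def evalAt {d : ℕ} {T : ℝ} (hT : 0 ≤ T) (t : ℝ) (γ : Traj d T) : Euc d :=
  γ (Set.projIcc 0 T hT t)

/-- Narrow convergence of a sequence of measures. -/
def NarrowTendsto {X : Type*} [TopologicalSpace X] [MeasurableSpace X]
    (μ : ℕ → Measure X) (ν : Measure X) : Prop :=
  ∀ f : BoundedContinuousFunction X ℝ,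
    Tendsto (fun n => ∫ x, f x ∂(μ n)) atTop (𝓝 (∫ x, f x ∂ν))

/-- Squared 2-Wasserstein distance. -/
def W2sq {X : Type*} [MeasurableSpace X] [PseudoMetricSpace X]
    (μ ν : Measure X) : ℝ≥0∞ :=
  ⨅ (π : Measure (X × X)) (_ : π.map Prod.fst = μ ∧ π.map Prod.snd = ν),
    ∫⁻ p, ENNReal.ofReal (dist p.1 p.2 ^ 2) ∂π

/-- Uniform discrete probability measures on `N` points. -/
def IsUnifDiscrete {X : Type*} [MeasurableSpace X] (N : ℕ) (μ : Measure X) : Prop :=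
  ∃ x : Fin N → X, μ = ((N : ℝ≥0∞))⁻¹ • ∑ i, MeasureTheory.Measure.dirac (x i)

/-- Shifted (by `+C`) kinetic action: equals `∫₀ᵀ (L(γ'(t)) + C) dt` if `γ ∈ W^{1,r}`,
`+∞` otherwise. -/
def actionN {d : ℕ} {T : ℝ} (L : Euc d → ℝ) (C : ℝ) (γ : Traj d T) : ℝ≥0∞ :=
  sInf { a : ℝ≥0∞ | ∃ g : ℝ → Euc d, IntervalIntegrable g volume 0 T ∧
      (∀ s t : Set.Icc (0:ℝ) T, γ t - γ s = ∫ u in (s:ℝ)..(t:ℝ), g u) ∧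
      a = ∫⁻ t in Set.Ioc (0:ℝ) T, ENNReal.ofReal (L (g t) + C) }

/-- Kinetic part of the energy: `∫_Γ L(γ) dQ(γ)`. -/
def kinE {d : ℕ} {T : ℝ} (L : Euc d → ℝ) (C : ℝ) (Q : Measure (Traj d T)) : EReal :=
  ((∫⁻ γ, actionN L C γ ∂Q : ℝ≥0∞) : EReal) - ((C * T : ℝ) : EReal)

/-- The mean-field game energy `J`. -/
def Jfun {d : ℕ} {T : ℝ} (hT : 0 ≤ T) (L : Euc d → ℝ) (C : ℝ)
    (F : Measure (Euc d) → ℝ≥0∞) (G : Measure (Traj d T) → ℝ)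
    (Q : Measure (Traj d T)) : EReal :=
  kinE L C Q
    + ((∫⁻ t in Set.Ioc (0:ℝ) T, F (Q.map (evalAt hT t)) : ℝ≥0∞) : EReal)
    + ((G Q : ℝ) : EReal)

/-- Moreau envelope of `F` with parameter `ε` in the 2-Wasserstein space. -/
def moreau {d : ℕ} (Ω : Set (Euc d)) (F : Measure (Euc d) → ℝ≥0∞) (ε : ℝ)
    (μ : Measure (Euc d)) : ℝ≥0∞ :=
  ⨅ (ρ : Measure (Euc d)) (_ : IsProbabilityMeasure ρ ∧ ρ Ωᶜ = 0),
    W2sq μ ρ / ENNReal.ofReal (2 * ε) + F ρ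

/-- The regularized energy `J_ε`. -/
def Jeps {d : ℕ} {T : ℝ} (hT : 0 ≤ T) (Ω : Set (Euc d)) (L : Euc d → ℝ) (C : ℝ)
    (F : Measure (Euc d) → ℝ≥0∞) (G : Measure (Traj d T) → ℝ) (ε : ℝ)
    (Q : Measure (Traj d T)) : EReal :=
  kinE L C Q
    + ((∫⁻ t in Set.Ioc (0:ℝ) T, moreau Ω F ε (Q.map (evalAt hT t)) : ℝ≥0∞) : EReal)
    + ((G Q : ℝ) : EReal)

end


/-! ### General facts on narrow convergence -/

lemma aux_ennreal_liminf_add (u v : ℕ → ℝ≥0∞) :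
    liminf u atTop + liminf v atTop ≤ liminf (fun n => u n + v n) atTop := by
  rw [Filter.liminf_eq_iSup_iInf_of_nat, Filter.liminf_eq_iSup_iInf_of_nat,
    Filter.liminf_eq_iSup_iInf_of_nat]
  rw [ENNReal.iSup_add_iSup]
  · refine iSup_mono fun n => ?_
    refine le_iInf₂ fun i hi => ?_
    exact add_le_add (iInf₂_le i hi) (iInf₂_le i hi)
  · intro i j
    refine ⟨max i j, add_le_add ?_ ?_⟩
    · exact le_iInf₂ fun k hk => iInf₂_le k (le_trans (le_max_left i j) hk)
    · exact le_iInf₂ fun k hk => iInf₂_le k (le_trans (le_max_right i j) hk)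

lemma aux_lintegral_lsc {X : Type*} [TopologicalSpace X] [MeasurableSpace X] [BorelSpace X]
    {μ : Measure X} {μs : ℕ → Measure X} {f : X → ℝ≥0∞} (hf : LowerSemicontinuous f)
    (h_opens : ∀ G, IsOpen G → μ G ≤ atTop.liminf (fun i ↦ μs i G)) :
    ∫⁻ x, f x ∂μ ≤ atTop.liminf (fun i ↦ ∫⁻ x, f x ∂(μs i)) := by
  have hfm : Measurable f := hf.measurable
  have key : ∀ k : ℕ, ∫⁻ x, min (f x) k ∂μ ≤ atTop.liminf (fun i ↦ ∫⁻ x, f x ∂(μs i)) := by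
    intro k
    have hgm : Measurable (fun x => (min (f x) (k : ℝ≥0∞)).toReal) :=
      (hfm.min measurable_const).ennreal_toReal
    have hfin : ∀ x, min (f x) (k : ℝ≥0∞) ≠ ⊤ := fun x =>
      ne_top_of_le_ne_top (ENNReal.natCast_ne_top k) (min_le_right _ _)
    have heq : ∀ ν : Measure X, ∫⁻ x, min (f x) k ∂ν
        = ∫⁻ t in Ioi (0:ℝ), ν {a | t < (min (f a) (k : ℝ≥0∞)).toReal} := by
      intro ν
      rw [← lintegral_eq_lintegral_meas_lt ν (Eventually.of_forall fun x => ENNReal.toReal_nonneg)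
        hgm.aemeasurable]
      refine lintegral_congr fun x => ?_
      rw [ENNReal.ofReal_toReal (hfin x)]
    calc ∫⁻ x, min (f x) k ∂μ
        = ∫⁻ t in Ioi (0:ℝ), μ {a | t < (min (f a) (k : ℝ≥0∞)).toReal} := heq μ
      _ ≤ ∫⁻ t in Ioi (0:ℝ), atTop.liminf
            (fun i => μs i {a | t < (min (f a) (k : ℝ≥0∞)).toReal}) := by
          refine setLIntegral_mono' measurableSet_Ioi fun t ht => h_opens _ ?_
          have : {a | t < (min (f a) (k : ℝ≥0∞)).toReal}
              = {a | ENNReal.ofReal t < f a} ∩ {a | ENNReal.ofReal t < (k : ℝ≥0∞)} := by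
            ext a
            simp only [mem_ofPred_eq, mem_inter_iff]
            rw [← ENNReal.ofReal_lt_iff_lt_toReal (le_of_lt ht) (hfin a), lt_min_iff]
          rw [this]
          exact (hf.isOpen_preimage _).inter isOpen_const
      _ ≤ atTop.liminf
            (fun i => ∫⁻ t in Ioi (0:ℝ), μs i {a | t < (min (f a) (k : ℝ≥0∞)).toReal}) := by
          exact lintegral_liminf_le (fun n ↦ Antitone.measurable (fun s t hst ↦
            measure_mono (fun ω hω ↦ lt_of_le_of_lt hst hω)))
      _ ≤ _ := by
          refine liminf_le_liminf (Eventually.of_forall fun i => ?_)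
          show _ ≤ _
          rw [← heq]
          exact lintegral_mono fun x => min_le_left _ _
  have hsup : ∫⁻ x, f x ∂μ = ⨆ k : ℕ, ∫⁻ x, min (f x) k ∂μ := by
    rw [← lintegral_iSup (fun k => hfm.min measurable_const)]
    · refine lintegral_congr fun x => ?_
      have h1 : (⨆ k : ℕ, min (f x) (k : ℝ≥0∞)) = min (f x) (⨆ k : ℕ, (k : ℝ≥0∞)) := by
        rw [← inf_iSup_eq]
      rw [h1, ENNReal.iSup_natCast]
      simp
    · intro i j hij x
      exact min_le_min le_rfl (by exact_mod_cast hij)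
  rw [hsup]
  exact iSup_le key

/-- Bundling of a probability measure. -/
def auxPM {X : Type*} [MeasurableSpace X] (μ : Measure X) (h : IsProbabilityMeasure μ) :
    ProbabilityMeasure X := ⟨μ, h⟩

lemma aux_narrow_prob {X : Type*} [TopologicalSpace X] [MeasurableSpace X]
    [OpensMeasurableSpace X]
    {μ : ℕ → Measure X} {ν : Measure X} (hμ : ∀ n, IsProbabilityMeasure (μ n))
    (hν : IsProbabilityMeasure ν) (h : NarrowTendsto μ ν) :
    Tendsto (fun n => auxPM (μ n) (hμ n)) atTop
      (𝓝 (auxPM ν hν)) :=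
  ProbabilityMeasure.tendsto_iff_forall_integral_tendsto.2 h

lemma aux_prob_narrow {X : Type*} [TopologicalSpace X] [MeasurableSpace X]
    [OpensMeasurableSpace X]
    {μ : ℕ → ProbabilityMeasure X} {ν : ProbabilityMeasure X}
    (h : Tendsto μ atTop (𝓝 ν)) :
    NarrowTendsto (fun n => (μ n : Measure X)) (ν : Measure X) := by
  rw [ProbabilityMeasure.tendsto_iff_forall_integral_tendsto] at h
  exact h

lemma aux_narrow_open {X : Type*} [TopologicalSpace X] [MeasurableSpace X]
    [OpensMeasurableSpace X] [HasOuterApproxClosed X]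
    {μ : ℕ → Measure X} {ν : Measure X} (hμ : ∀ n, IsProbabilityMeasure (μ n))
    (hν : IsProbabilityMeasure ν) (h : NarrowTendsto μ ν) (G : Set X) (hG : IsOpen G) :
    ν G ≤ atTop.liminf (fun i ↦ μ i G) :=
  ProbabilityMeasure.le_liminf_measure_open_of_tendsto (aux_narrow_prob hμ hν h) hG

lemma aux_narrow_map {X Y : Type*} [TopologicalSpace X] [MeasurableSpace X] [BorelSpace X]
    [TopologicalSpace Y] [MeasurableSpace Y] [BorelSpace Y]
    [TopologicalSpace.PseudoMetrizableSpace Y] [SecondCountableTopology Y]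
    {μ : ℕ → Measure X} {ν : Measure X} (h : NarrowTendsto μ ν) {g : X → Y} (hg : Continuous g) :
    NarrowTendsto (fun n => (μ n).map g) (ν.map g) := by
  intro f
  have h1 := h (f.compContinuous ⟨g, hg⟩)
  have e : ∀ m : Measure X, ∫ y, f y ∂(m.map g) = ∫ x, f.compContinuous ⟨g, hg⟩ x ∂m := by
    intro m
    rw [integral_map hg.measurable.aemeasurable f.continuous.aestronglyMeasurable]
    rfl
  simp only [e]
  exact h1

lemma aux_narrow_unique {X : Type*} [TopologicalSpace X] [MeasurableSpace X]
    [HasOuterApproxClosed X] [BorelSpace X]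
    {μ : ℕ → Measure X} {ν ν' : Measure X} [IsFiniteMeasure ν] [IsFiniteMeasure ν']
    (h : NarrowTendsto μ ν) (h' : NarrowTendsto μ ν') : ν = ν' :=
  ext_of_forall_integral_eq_of_IsFiniteMeasure fun f => tendsto_nhds_unique (h f) (h' f)

lemma aux_narrow_subseq {X : Type*} [TopologicalSpace X] [MeasurableSpace X]
    {μ : ℕ → Measure X} {ν : Measure X} (h : NarrowTendsto μ ν) {φ : ℕ → ℕ} (hφ : StrictMono φ) :
    NarrowTendsto (fun n => μ (φ n)) ν :=
  fun f => (h f).comp hφ.tendsto_atTop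

lemma aux_moreau_plan {d : ℕ} (Ω : Set (Euc d)) (F : Measure (Euc d) → ℝ≥0∞) (ε : ℝ)
    (hε : 0 < ε) (μ : Measure (Euc d)) (c : ℝ≥0∞) (h : moreau Ω F ε μ < c) :
    ∃ π : Measure (Euc d × Euc d), π.map Prod.fst = μ ∧ IsProbabilityMeasure (π.map Prod.snd) ∧
      (π.map Prod.snd) Ωᶜ = 0 ∧
      (∫⁻ p, ENNReal.ofReal (dist p.1 p.2 ^ 2) ∂π) / ENNReal.ofReal (2 * ε) + F (π.map Prod.snd)
        < c := by
  have ha0 : ENNReal.ofReal (2 * ε) ≠ 0 := by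
    simp only [ne_eq, ENNReal.ofReal_eq_zero, not_le]; positivity
  unfold moreau at h
  simp only [iInf_lt_iff] at h
  obtain ⟨ρ, ⟨hρ1, hρ2⟩, h⟩ := h
  by_contra hcon
  push Not at hcon
  refine absurd h (not_lt.2 ?_)
  rw [← tsub_le_iff_right, ENNReal.le_div_iff_mul_le (Or.inl ha0) (Or.inl ENNReal.ofReal_ne_top)]
  unfold W2sq
  refine le_iInf₂ fun π hπ => ?_
  rw [← ENNReal.le_div_iff_mul_le (Or.inl ha0) (Or.inl ENNReal.ofReal_ne_top), tsub_le_iff_right]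
  have := hcon π hπ.1 (by rw [hπ.2]; exact hρ1) (by rw [hπ.2]; exact hρ2)
  rwa [hπ.2] at this

lemma aux_moreau_lsc {d : ℕ} (Ω : Set (Euc d)) (hΩc : IsCompact Ω)
    (F : Measure (Euc d) → ℝ≥0∞)
    (hFlsc : ∀ (ρ : ℕ → Measure (Euc d)) (σ : Measure (Euc d)),
      (∀ n, IsFiniteMeasure (ρ n)) → IsFiniteMeasure σ → NarrowTendsto ρ σ →
      F σ ≤ liminf (fun n => F (ρ n)) atTop)
    (ε : ℝ) (hε : 0 < ε) (μ : ℕ → Measure (Euc d)) (ν : Measure (Euc d))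
    (hμ : ∀ n, IsProbabilityMeasure (μ n)) (hν : IsProbabilityMeasure ν)
    (h : NarrowTendsto μ ν) :
    moreau Ω F ε ν ≤ liminf (fun n => moreau Ω F ε (μ n)) atTop := by
  have ha0 : ENNReal.ofReal (2 * ε) ≠ 0 := by
    simp only [ne_eq, ENNReal.ofReal_eq_zero, not_le]; positivity
  by_contra hcon
  push Not at hcon
  obtain ⟨c, hc1, hc2⟩ := exists_between hcon
  have hfreq := frequently_lt_of_liminf_lt (by isBoundedDefault) hc1
  obtain ⟨φ, hφ, hφc⟩ := extraction_of_frequently_atTop hfreq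
  choose π hπ1 hπ2 hπ3 hπ4 using fun n => aux_moreau_plan Ω F ε hε (μ (φ n)) c (hφc n)
  have hπp : ∀ n, IsProbabilityMeasure (π n) := by
    intro n
    constructor
    have := (hμ (φ n)).measure_univ
    rwa [← hπ1 n, Measure.map_apply measurable_fst MeasurableSet.univ, preimage_univ] at this
  let P : ℕ → ProbabilityMeasure (Euc d × Euc d) := fun n => auxPM (π n) (hπp n)
  have htight : IsTightMeasureSet
      {((m : ProbabilityMeasure (Euc d × Euc d)) : Measure (Euc d × Euc d)) | m ∈ range P} := by
    apply IsTightMeasureSet.prodMk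
    · have hcomp : IsCompact (closure (range (fun n => auxPM (μ n) (hμ n)))) := by
        have := (aux_narrow_prob hμ hν h).isCompact_insert_range
        exact this.closure_of_subset (subset_insert _ _)
      refine (isTightMeasureSet_of_isCompact_closure hcomp).subset ?_
      rintro _ ⟨_, ⟨_, ⟨n, rfl⟩, rfl⟩, rfl⟩
      refine ⟨auxPM (μ (φ n)) (hμ (φ n)), ⟨φ n, rfl⟩, ?_⟩
      exact (hπ1 n).symm
    · rw [isTightMeasureSet_iff_exists_isCompact_measure_compl_le]
      intro e he
      refine ⟨Ω, hΩc, ?_⟩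
      rintro _ ⟨_, ⟨_, ⟨n, rfl⟩, rfl⟩, rfl⟩
      have : (Measure.snd (P n : Measure (Euc d × Euc d))) Ωᶜ = 0 := hπ3 n
      rw [this]; exact zero_le
  have hK := isCompact_closure_of_isTightMeasureSet htight
  obtain ⟨p, -, ψ, hψ, hp⟩ := hK.tendsto_subseq (fun n => subset_closure (mem_range_self n))
  have hnar : NarrowTendsto (fun n => π (ψ n)) (p : Measure _) := aux_prob_narrow hp
  have hpp : IsProbabilityMeasure (p : Measure (Euc d × Euc d)) := inferInstance
  have hfst : (p : Measure (Euc d × Euc d)).map Prod.fst = ν := by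
    have h1 := aux_narrow_map hnar continuous_fst
    simp only [hπ1] at h1
    have h2 := aux_narrow_subseq (aux_narrow_subseq h hφ) hψ
    exact aux_narrow_unique h1 h2
  have hsnd := aux_narrow_map hnar continuous_snd
  have hsp : IsProbabilityMeasure ((p : Measure (Euc d × Euc d)).map Prod.snd) :=
    Measure.isProbabilityMeasure_map measurable_snd.aemeasurable
  have hs0 : ((p : Measure (Euc d × Euc d)).map Prod.snd) Ωᶜ = 0 := by
    have := aux_narrow_open (fun n => hπ2 (ψ n)) hsp hsnd Ωᶜ hΩc.isClosed.isOpen_compl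
    simp only [hπ3] at this
    simpa using this
  have hF := hFlsc _ _ (fun n => (by have := hπ2 (ψ n); infer_instance)) inferInstance hsnd
  have hcost : ∀ m : Measure (Euc d × Euc d),
      (∫⁻ p, ENNReal.ofReal (dist p.1 p.2 ^ 2) ∂m) / ENNReal.ofReal (2 * ε)
       = ∫⁻ p, ENNReal.ofReal (dist p.1 p.2 ^ 2) / ENNReal.ofReal (2 * ε) ∂m := by
    intro m
    simp only [div_eq_mul_inv]
    rw [lintegral_mul_const]
    fun_prop
  have hI : (∫⁻ q, ENNReal.ofReal (dist q.1 q.2 ^ 2) ∂(p : Measure (Euc d × Euc d)))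
        / ENNReal.ofReal (2 * ε) ≤ liminf (fun n => (∫⁻ q, ENNReal.ofReal (dist q.1 q.2 ^ 2)
          ∂(π (ψ n))) / ENNReal.ofReal (2 * ε)) atTop := by
    simp only [hcost]
    apply aux_lintegral_lsc
    · apply Continuous.lowerSemicontinuous
      simp only [div_eq_mul_inv]
      apply ENNReal.continuous_mul_const (by simpa using hε) |>.comp
      exact ENNReal.continuous_ofReal.comp (by fun_prop)
    · exact aux_narrow_open (fun n => hπp (ψ n)) hpp hnar
  have hfinal : moreau Ω F ε ν ≤ c := by
    calc moreau Ω F ε ν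
        ≤ W2sq ν ((p : Measure (Euc d × Euc d)).map Prod.snd) / ENNReal.ofReal (2 * ε)
          + F ((p : Measure (Euc d × Euc d)).map Prod.snd) := iInf₂_le _ ⟨hsp, hs0⟩
      _ ≤ (∫⁻ q, ENNReal.ofReal (dist q.1 q.2 ^ 2) ∂(p : Measure (Euc d × Euc d)))
        / ENNReal.ofReal (2 * ε) + F ((p : Measure (Euc d × Euc d)).map Prod.snd) := by
          gcongr
          exact iInf₂_le _ ⟨hfst, rfl⟩
      _ ≤ _ := add_le_add hI hF
      _ ≤ _ := aux_ennreal_liminf_add _ _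
      _ ≤ c := by
          refine liminf_le_of_frequently_le' (Frequently.of_forall fun n => ?_)
          exact (hπ4 (ψ n)).le
  exact absurd hc2 (not_lt.2 hfinal)

/-! ### The action functional -/

lemma aux_action_lt {d : ℕ} {T : ℝ} (hT : 0 < T) (L : Euc d → ℝ) (hLcont : Continuous L) (C : ℝ)
    (hL0 : ∀ p, 0 ≤ L p + C) (γ : Traj d T) (c : ℝ≥0∞) (hc : actionN L C γ < c) :
    ∃ g : ℝ → Euc d, Measurable g ∧ IntegrableOn g (Ioc 0 T) ∧
      (∀ s ∈ Icc 0 T, ∀ t ∈ Icc 0 T, s ≤ t →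
        evalAt hT.le t γ - evalAt hT.le s γ = ∫ u in Ioc s t, g u) ∧
      IntegrableOn (fun u => L (g u) + C) (Ioc 0 T) ∧
      ENNReal.ofReal (∫ u in Ioc 0 T, (L (g u) + C)) < c := by
  unfold actionN at hc
  obtain ⟨a, ⟨g, hgi, hg, rfl⟩, hac⟩ := sInf_lt_iff.1 hc
  have hgi' : IntegrableOn g (Ioc 0 T) := (intervalIntegrable_iff_integrableOn_Ioc_of_le hT.le).1 hgi
  have hae : g =ᵐ[volume.restrict (Ioc 0 T)] hgi'.1.mk g := hgi'.1.ae_eq_mk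
  have hm : Measurable (hgi'.1.mk g) := hgi'.1.stronglyMeasurable_mk.measurable
  set g' := hgi'.1.mk g with hg'
  have hgi2 : IntegrableOn g' (Ioc 0 T) := hgi'.congr hae
  have hlin : ∫⁻ t in Ioc (0:ℝ) T, ENNReal.ofReal (L (g t) + C)
      = ∫⁻ t in Ioc (0:ℝ) T, ENNReal.ofReal (L (g' t) + C) := by
    apply lintegral_congr_ae
    filter_upwards [hae] with t ht
    rw [ht]
  rw [hlin] at hac
  have hLm : Measurable (fun u => L (g' u) + C) := (hLcont.measurable.comp hm).add_const C
  have hLi : IntegrableOn (fun u => L (g' u) + C) (Ioc 0 T) := by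
    refine ⟨hLm.aestronglyMeasurable, ?_⟩
    rw [hasFiniteIntegral_iff_ofReal (Eventually.of_forall fun u => hL0 _)]
    exact lt_of_lt_of_le hac le_top
  refine ⟨g', hm, hgi2, ?_, hLi, ?_⟩
  · intro s hs t ht hst
    have h1 := hg ⟨s, hs⟩ ⟨t, ht⟩
    have e1 : evalAt hT.le t γ = γ ⟨t, ht⟩ := by
      unfold evalAt; rw [projIcc_of_mem hT.le ht]
    have e2 : evalAt hT.le s γ = γ ⟨s, hs⟩ := by
      unfold evalAt; rw [projIcc_of_mem hT.le hs]
    rw [e1, e2, h1, intervalIntegral.integral_of_le hst]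
    refine integral_congr_ae ?_
    exact ae_restrict_of_ae_restrict_of_subset (Ioc_subset_Ioc hs.1 ht.2) hae
  · rw [ofReal_integral_eq_lintegral_ofReal hLi (Eventually.of_forall fun u => hL0 _)]
    exact hac

lemma aux_continuous_eval {d : ℕ} {T : ℝ} (hT : 0 ≤ T) (γ : Traj d T) :
    Continuous (fun t => evalAt hT t γ) :=
  γ.continuous.comp continuous_projIcc

lemma aux_continuous_eval' {d : ℕ} {T : ℝ} (hT : 0 ≤ T) (t : ℝ) :
    Continuous (fun γ : Traj d T => evalAt hT t γ) :=
  continuous_eval_const (projIcc 0 T hT t)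

/-- Difference-quotient functional. -/
noncomputable def auxPhi {d : ℕ} {T : ℝ} (hT : 0 ≤ T) (L : Euc d → ℝ) (C : ℝ) (h : ℝ) (γ : Traj d T) : ℝ≥0∞ :=
  ∫⁻ t in Ioc 0 (T - h),
    ENNReal.ofReal (L (h⁻¹ • (evalAt hT (t + h) γ - evalAt hT t γ)) + C)

lemma aux_phi_le {d : ℕ} {T : ℝ} (hT : 0 < T) (L : Euc d → ℝ) (hLconv : ConvexOn ℝ Set.univ L)
    (hLcont : Continuous L) (C : ℝ)
    (hL0 : ∀ p, 0 ≤ L p + C) (γ : Traj d T) (c : ℝ≥0∞) (hc : actionN L C γ < c)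
    (h : ℝ) (hh : 0 < h) : auxPhi hT.le L C h γ ≤ c := by
  obtain ⟨g, hgm, hgi, hg, hLi, hlt⟩ := aux_action_lt hT L hLcont C hL0 γ c hc
  rw [ofReal_integral_eq_lintegral_ofReal hLi (Eventually.of_forall fun u => hL0 _)] at hlt
  have hLm : Measurable (fun u => ENNReal.ofReal (L (g u) + C)) :=
    ((hLcont.measurable.comp hgm).add_const C).ennreal_ofReal
  set f : ℝ → ℝ≥0∞ := (Ioc 0 T).indicator (fun u => ENNReal.ofReal (L (g u) + C)) with hf
  have hfm : Measurable f := hLm.indicator measurableSet_Ioc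
  have hfa : ∫⁻ u, f u = ∫⁻ u in Ioc 0 T, ENNReal.ofReal (L (g u) + C) :=
    lintegral_indicator measurableSet_Ioc _
  have hconv2 : ConvexOn ℝ Set.univ (fun p => L p + C) := hLconv.add_const C
  have step : ∀ t ∈ Ioc 0 (T - h),
      ENNReal.ofReal (L (h⁻¹ • (evalAt hT.le (t + h) γ - evalAt hT.le t γ)) + C)
        ≤ ENNReal.ofReal h⁻¹ * ∫⁻ u in Ioc 0 h, f (t + u) := by
    intro t ht
    have hsub : Ioc t (t + h) ⊆ Ioc 0 T := Ioc_subset_Ioc ht.1.le (by linarith [ht.2])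
    have hvol : volume.real (Ioc t (t + h)) = h := by
      rw [Real.volume_real_Ioc_of_le (by linarith)]; ring
    rw [hg t ⟨ht.1.le, by linarith [ht.2]⟩ (t + h) ⟨by linarith [ht.1], by linarith [ht.2]⟩
      (by linarith)]
    have hJ := hconv2.map_set_average_le (μ := volume) (t := Ioc t (t + h)) (f := g)
      (hLcont.add continuous_const).continuousOn isClosed_univ
      (by simp [hh]) (by simp) (by simp) (hgi.mono_set hsub) (hLi.mono_set hsub)
    rw [setAverage_eq, setAverage_eq, hvol] at hJ
    refine (ENNReal.ofReal_le_ofReal hJ).trans ?_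
    rw [smul_eq_mul, ENNReal.ofReal_mul (by positivity),
      ofReal_integral_eq_lintegral_ofReal (hLi.mono_set hsub) (Eventually.of_forall fun u => hL0 _)]
    refine mul_le_mul' le_rfl ?_
    have e1 : ∫⁻ u in Ioc t (t + h), ENNReal.ofReal (L (g u) + C)
        = ∫⁻ u in Ioc t (t + h), f u := by
      refine setLIntegral_congr_fun measurableSet_Ioc fun u hu => ?_
      rw [hf, indicator_of_mem (hsub hu)]
    rw [e1, ← lintegral_indicator measurableSet_Ioc, ← lintegral_indicator measurableSet_Ioc,
      ← lintegral_add_left_eq_self _ t]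
    refine lintegral_mono fun u => ?_
    by_cases hu : u ∈ Ioc 0 h
    · rw [indicator_of_mem hu]
      exact indicator_le_self _ _ _
    · rw [indicator_of_notMem hu, indicator_of_notMem]
      intro hcon
      exact hu ⟨by linarith [hcon.1], by linarith [hcon.2]⟩
  have hfinal : auxPhi hT.le L C h γ ≤ ∫⁻ u, f u := by
    calc auxPhi hT.le L C h γ
        ≤ ∫⁻ t in Ioc 0 (T - h), ENNReal.ofReal h⁻¹ * ∫⁻ u in Ioc 0 h, f (t + u) :=
          setLIntegral_mono' measurableSet_Ioc step
      _ ≤ ∫⁻ t, ENNReal.ofReal h⁻¹ * ∫⁻ u in Ioc 0 h, f (t + u) := setLIntegral_le_lintegral _ _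
      _ = ENNReal.ofReal h⁻¹ * ∫⁻ t, ∫⁻ u in Ioc 0 h, f (t + u) :=
          lintegral_const_mul' _ _ ENNReal.ofReal_ne_top
      _ = ENNReal.ofReal h⁻¹ * ∫⁻ u in Ioc 0 h, ∫⁻ t, f (t + u) := by
          rw [lintegral_lintegral_swap]
          exact (hfm.comp measurable_add).aemeasurable
      _ = ENNReal.ofReal h⁻¹ * ∫⁻ u in Ioc 0 h, ∫⁻ t, f t := by
          simp only [lintegral_add_right_eq_self]
      _ = ∫⁻ u, f u := by
          rw [setLIntegral_const, Real.volume_Ioc, sub_zero, mul_comm, mul_assoc,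
            ← ENNReal.ofReal_mul hh.le, mul_inv_cancel₀ hh.ne', ENNReal.ofReal_one, mul_one]
  rw [hfa] at hfinal
  exact hfinal.trans hlt.le

lemma aux_phi_lsc {d : ℕ} {T : ℝ} (hT : 0 ≤ T) (L : Euc d → ℝ)
    (hLcont : Continuous L) (C h : ℝ) (γ : ℕ → Traj d T) (γ' : Traj d T)
    (hγ : Tendsto γ atTop (𝓝 γ')) (c : ℝ≥0∞) (hc : ∀ n, auxPhi hT L C h (γ n) ≤ c) :
    auxPhi hT L C h γ' ≤ c := by
  unfold auxPhi at *
  have hpt : ∀ t, Tendsto (fun n =>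
      ENNReal.ofReal (L (h⁻¹ • (evalAt hT (t + h) (γ n) - evalAt hT t (γ n))) + C)) atTop
      (𝓝 (ENNReal.ofReal (L (h⁻¹ • (evalAt hT (t + h) γ' - evalAt hT t γ')) + C))) := by
    intro t
    have hcont : Continuous (fun η : Traj d T =>
        ENNReal.ofReal (L (h⁻¹ • (evalAt hT (t + h) η - evalAt hT t η)) + C)) := by
      have h1 := aux_continuous_eval' (d := d) hT (t + h)
      have h2 := aux_continuous_eval' (d := d) hT t
      refine ENNReal.continuous_ofReal.comp ?_
      fun_prop
    exact (hcont.tendsto γ').comp hγ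
  have hmeas : ∀ η : Traj d T, Measurable (fun t =>
      ENNReal.ofReal (L (h⁻¹ • (evalAt hT (t + h) η - evalAt hT t η)) + C)) := by
    intro η
    have : Continuous (fun t =>
      ENNReal.ofReal (L (h⁻¹ • (evalAt hT (t + h) η - evalAt hT t η)) + C)) := by
      have h1 := aux_continuous_eval hT η
      have h2 : Continuous (fun t => evalAt hT (t + h) η) :=
        (aux_continuous_eval hT η).comp (continuous_id.add continuous_const)
      refine ENNReal.continuous_ofReal.comp ?_
      fun_prop
    exact this.measurable
  calc _ = ∫⁻ t in Ioc 0 (T - h), liminf (fun n =>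
      ENNReal.ofReal (L (h⁻¹ • (evalAt hT (t + h) (γ n) - evalAt hT t (γ n))) + C)) atTop :=
        lintegral_congr fun t => (hpt t).liminf_eq.symm
    _ ≤ _ := lintegral_liminf_le fun n => hmeas (γ n)
    _ ≤ c := liminf_le_of_frequently_le' (Frequently.of_forall hc)

lemma aux_young (r K x : ℝ) (hr : 1 < r) (hK : 0 < K) (hx : 0 ≤ x) :
    x ≤ K + K ^ (1 - r) * x ^ r := by
  rcases le_or_gt x K with h | h
  · have : 0 ≤ K ^ (1 - r) * x ^ r := by positivity
    linarith
  · have hx0 : 0 < x := hK.trans h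
    have h1 : x ^ (1 - r) ≤ K ^ (1 - r) :=
      Real.rpow_le_rpow_of_nonpos hK h.le (by linarith)
    have h2 : x = x ^ (1 - r) * x ^ r := by
      rw [← Real.rpow_add hx0]; simp
    have h3 : x ^ (1 - r) * x ^ r ≤ K ^ (1 - r) * x ^ r := by gcongr
    linarith

lemma aux_sum_bound {d : ℕ} {T : ℝ} (hT : 0 < T) (r C : ℝ) (hr : 1 < r) (hC : 0 < C)
    (L : Euc d → ℝ) (hLcont : Continuous L)
    (hLg : ∀ p : Euc d, ‖p‖ ^ r ≤ r * C * (L p + C))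
    (hL0 : ∀ p, 0 ≤ L p + C) (γ : Traj d T) (A : ℝ) (hA : 0 < A)
    (hc : actionN L C γ < ENNReal.ofReal A) (K : ℝ) (hK : 0 < K)
    (E : ℕ × (ℕ → ℝ × ℝ)) (hE : E ∈ AbsolutelyContinuousOnInterval.disjWithin 0 T) :
    ∑ i ∈ Finset.range E.1, dist (evalAt hT.le (E.2 i).1 γ) (evalAt hT.le (E.2 i).2 γ)
      ≤ K * ∑ i ∈ Finset.range E.1, dist (E.2 i).1 (E.2 i).2 + K ^ (1 - r) * (r * C) * A := by
  obtain ⟨g, hgm, hgi, hg, hLi, hlt⟩ := aux_action_lt hT L hLcont C hL0 γ _ hc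
  have hlt' : ∫ u in Ioc 0 T, (L (g u) + C) ≤ A := by
    have := (ENNReal.ofReal_lt_ofReal_iff hA).1 hlt
    exact this.le
  obtain ⟨n, I⟩ := E
  have hsub : ∀ i ∈ Finset.range n, uIoc (I i).1 (I i).2 ⊆ Ioc 0 T := by
    intro i hi
    have := AbsolutelyContinuousOnInterval.uIoc_subset_of_mem_disjWithin hE (Finset.mem_range.1 hi)
    rwa [uIoc_of_le hT.le] at this
  have hone : ∀ s ∈ Icc 0 T, ∀ t ∈ Icc 0 T, s ≤ t →
      dist (evalAt hT.le s γ) (evalAt hT.le t γ) ≤ K * dist s t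
        + K ^ (1 - r) * (r * C) * ∫ u in Ioc s t, (L (g u) + C) := by
    intro s hs t ht hst
    have hss : Ioc s t ⊆ Ioc 0 T := Ioc_subset_Ioc hs.1 ht.2
    rw [dist_comm, dist_eq_norm, hg s hs t ht hst]
    calc ‖∫ u in Ioc s t, g u‖ ≤ ∫ u in Ioc s t, ‖g u‖ := norm_integral_le_integral_norm _
      _ ≤ ∫ u in Ioc s t, (K + K ^ (1 - r) * (r * C) * (L (g u) + C)) := by
          refine integral_mono (hgi.mono_set hss).norm ?_ ?_
          · exact (integrable_const K).add ((hLi.mono_set hss).const_mul _)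
          · intro u
            have h1 := aux_young r K ‖g u‖ hr hK (norm_nonneg _)
            have h2 := hLg (g u)
            have h3 : 0 < K ^ (1 - r) := by positivity
            have h4 := mul_le_mul_of_nonneg_left h2 h3.le
            show ‖g u‖ ≤ _
            nlinarith
      _ = _ := by
          rw [integral_add (integrable_const K) ((hLi.mono_set hss).const_mul _),
            integral_const_mul, setIntegral_const, Real.volume_real_Ioc_of_le hst, smul_eq_mul,
            dist_comm s t, Real.dist_eq, abs_of_nonneg (sub_nonneg.2 hst)]
          ring
  have hone' : ∀ i ∈ Finset.range n,
      dist (evalAt hT.le (I i).1 γ) (evalAt hT.le (I i).2 γ) ≤ K * dist (I i).1 (I i).2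
        + K ^ (1 - r) * (r * C) * ∫ u in uIoc (I i).1 (I i).2, (L (g u) + C) := by
    intro i hi
    have hmem := hE.1 i hi
    rw [uIcc_of_le hT.le] at hmem
    rcases le_total (I i).1 (I i).2 with h | h
    · rw [uIoc_of_le h]
      exact hone _ hmem.1 _ hmem.2 h
    · rw [uIoc_of_ge h, dist_comm, dist_comm (I i).1]
      exact hone _ hmem.2 _ hmem.1 h
  have hsum : ∑ i ∈ Finset.range n, ∫ u in uIoc (I i).1 (I i).2, (L (g u) + C) ≤ A := by
    rw [← integral_biUnion_finset _ (fun i _ => measurableSet_uIoc) hE.2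
      (fun i hi => hLi.mono_set (hsub i hi))]
    refine le_trans (setIntegral_mono_set hLi (Eventually.of_forall fun u => hL0 _) ?_) hlt'
    exact (iUnion₂_subset hsub).eventuallyLE
  calc _ ≤ ∑ i ∈ Finset.range n, (K * dist (I i).1 (I i).2
        + K ^ (1 - r) * (r * C) * ∫ u in uIoc (I i).1 (I i).2, (L (g u) + C)) :=
        Finset.sum_le_sum hone'
    _ = K * ∑ i ∈ Finset.range n, dist (I i).1 (I i).2 + K ^ (1 - r) * (r * C) *
          ∑ i ∈ Finset.range n, ∫ u in uIoc (I i).1 (I i).2, (L (g u) + C) := by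
        rw [Finset.sum_add_distrib, Finset.mul_sum, Finset.mul_sum]
    _ ≤ _ := by
        have : 0 ≤ K ^ (1 - r) * (r * C) := by positivity
        gcongr

lemma aux_rpow_small (r D η : ℝ) (hr : 1 < r) (hη : 0 < η) :
    ∃ K : ℝ, 0 < K ∧ K ^ (1 - r) * D < η := by
  have h1 : Tendsto (fun K : ℝ => K ^ (-(r - 1)) * D) atTop (𝓝 (0 * D)) :=
    (tendsto_rpow_neg_atTop (by linarith)).mul_const D
  rw [zero_mul] at h1
  obtain ⟨K, hK1, hK2⟩ := ((h1.eventually (gt_mem_nhds hη)).and (eventually_gt_atTop 0)).exists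
  refine ⟨K, hK2, ?_⟩
  have : 1 - r = -(r - 1) := by ring
  rw [this]; exact hK1

lemma aux_action_le_of_ac {d : ℕ} {T : ℝ} (hT : 0 < T) (L : Euc d → ℝ)
    (hLcont : Continuous L) (C : ℝ) (γ : Traj d T)
    (hac : AbsolutelyContinuousOnInterval (fun t => evalAt hT.le t γ) 0 T) (c : ℝ≥0∞)
    (hphi : ∀ h, 0 < h → auxPhi hT.le L C h γ ≤ c) : actionN L C γ ≤ c := by
  set f : ℝ → Euc d := fun t => evalAt hT.le t γ with hf
  have haci : ∀ i, AbsolutelyContinuousOnInterval (fun t => f t i) 0 T := by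
    intro i
    rw [absolutelyContinuousOnInterval_iff] at hac ⊢
    intro e he
    obtain ⟨δ, hδ, h⟩ := hac e he
    refine ⟨δ, hδ, fun E hE hl => lt_of_le_of_lt (Finset.sum_le_sum fun j _ => ?_) (h E hE hl)⟩
    rw [dist_eq_norm, dist_eq_norm]
    exact PiLp.norm_apply_le (f (E.2 j).1 - f (E.2 j).2) i
  have hsum : ∀ x : Euc d, x = ∑ i, x i • EuclideanSpace.single i (1:ℝ) := by
    intro x
    ext j
    simp [Finset.sum_apply, Pi.single_apply]
  set g : ℝ → Euc d := fun t => ∑ i, deriv (fun s => f s i) t • EuclideanSpace.single i (1:ℝ)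
    with hg
  have hint : ∀ i, ∀ s ∈ Icc 0 T, ∀ t ∈ Icc 0 T,
      IntervalIntegrable (deriv (fun s => f s i)) volume s t := by
    intro i s hs t ht
    refine ((haci i).mono ?_).intervalIntegrable_deriv
    rw [uIcc_of_le hT.le]
    exact uIcc_subset_Icc hs ht
  have hint2 : ∀ i, ∀ s ∈ Icc 0 T, ∀ t ∈ Icc 0 T,
      IntervalIntegrable (fun u => deriv (fun s => f s i) u •
        (EuclideanSpace.single i (1:ℝ) : Euc d)) volume s t := by
    intro i s hs t ht
    exact ⟨(hint i s hs t ht).1.smul_const _, (hint i s hs t ht).2.smul_const _⟩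
  have h0T : (0:ℝ) ∈ Icc 0 T := ⟨le_rfl, hT.le⟩
  have hTT : T ∈ Icc 0 T := ⟨hT.le, le_rfl⟩
  have hgi : IntervalIntegrable g volume 0 T := by
    have : g = ∑ i, fun t => deriv (fun s => f s i) t • EuclideanSpace.single i (1:ℝ) := by
      ext t; simp [hg]
    rw [this]
    refine IntervalIntegrable.sum _ fun i _ => ?_
    exact hint2 i 0 h0T T hTT
  have hftc : ∀ s t : Set.Icc (0:ℝ) T, γ t - γ s = ∫ u in (s:ℝ)..(t:ℝ), g u := by
    intro s t
    rw [hg, intervalIntegral.integral_finsetSum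
      (fun i _ => hint2 i s s.2 t t.2)]
    have : ∀ i, ∫ u in (s:ℝ)..(t:ℝ), deriv (fun s => f s i) u • EuclideanSpace.single i (1:ℝ)
        = (γ t - γ s) i • (EuclideanSpace.single i (1:ℝ) : Euc d) := by
      intro i
      rw [intervalIntegral.integral_smul_const,
        ((haci i).mono (by rw [uIcc_of_le hT.le]; exact uIcc_subset_Icc s.2 t.2)
          ).integral_deriv_eq_sub]
      simp [hf, evalAt, projIcc_val]
    simp only [this]
    exact hsum _
  have hder : ∀ᵐ t, t ∈ Icc 0 T → HasDerivAt f (g t) t := by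
    have : ∀ i, ∀ᵐ t, t ∈ uIcc 0 T → DifferentiableAt ℝ (fun s => f s i) t :=
      fun i => (haci i).ae_differentiableAt
    filter_upwards [ae_all_iff.2 this] with t ht htm
    have hfe : f = fun s => ∑ i, f s i • EuclideanSpace.single i (1:ℝ) := by
      ext1 s; exact hsum _
    rw [hfe]
    refine HasDerivAt.fun_sum fun i _ => ?_
    exact (ht i (by rwa [uIcc_of_le hT.le])).hasDerivAt.smul_const _
  have hle0 : actionN L C γ ≤ ∫⁻ t in Set.Ioc (0:ℝ) T, ENNReal.ofReal (L (g t) + C) :=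
    sInf_le ⟨g, hgi, hftc, rfl⟩
  refine hle0.trans ?_
  -- Fatou along `h = 1/(k+1)`
  set h : ℕ → ℝ := fun k => 1 / ((k:ℝ) + 1) with hh
  have hpos : ∀ k, 0 < h k := fun k => Nat.one_div_pos_of_nat
  have hlim : Tendsto h atTop (𝓝 0) := tendsto_one_div_add_atTop_nhds_zero_nat
  set F : ℕ → ℝ → ℝ≥0∞ := fun k t => (Ioc 0 (T - h k)).indicator (fun t =>
    ENNReal.ofReal (L ((h k)⁻¹ • (f (t + h k) - f t)) + C)) t with hF
  have hfc : Continuous f := aux_continuous_eval hT.le γ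
  have hFm : ∀ k, Measurable (F k) := by
    intro k
    refine Measurable.indicator ?_ measurableSet_Ioc
    refine Continuous.measurable (ENNReal.continuous_ofReal.comp ?_)
    fun_prop
  have hFint : ∀ k, ∫⁻ t in Ioc 0 T, F k t ≤ c := by
    intro k
    refine (setLIntegral_le_lintegral _ _).trans ?_
    rw [hF]
    simp only
    rw [lintegral_indicator measurableSet_Ioc]
    exact hphi (h k) (hpos k)
  have hle : ∫⁻ t in Ioc 0 T, ENNReal.ofReal (L (g t) + C)
      ≤ ∫⁻ t in Ioc 0 T, liminf (fun k => F k t) atTop := by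
    refine lintegral_mono_ae ?_
    rw [ae_restrict_iff' measurableSet_Ioc]
    have hneT : ∀ᵐ t : ℝ, t ≠ T := by simp [ae_iff, measure_singleton]
    filter_upwards [hder, hneT] with t ht htT htm
    have hd := ht ⟨htm.1.le, htm.2⟩
    have hlt : t < T := lt_of_le_of_ne htm.2 htT
    have hslope : Tendsto (fun k => (h k)⁻¹ • (f (t + h k) - f t)) atTop (𝓝 (g t)) := by
      have h1 := hasDerivAt_iff_tendsto_slope_zero.1 hd
      refine h1.comp ?_
      rw [tendsto_nhdsWithin_iff]
      exact ⟨hlim, Eventually.of_forall fun k => (hpos k).ne'⟩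
    have hconv : Tendsto (fun k => F k t) atTop (𝓝 (ENNReal.ofReal (L (g t) + C))) := by
      have h2 : Tendsto (fun k => ENNReal.ofReal (L ((h k)⁻¹ • (f (t + h k) - f t)) + C)) atTop
          (𝓝 (ENNReal.ofReal (L (g t) + C))) :=
        ENNReal.tendsto_ofReal (((hLcont.tendsto _).comp hslope).add_const C)
      refine h2.congr' ?_
      filter_upwards [hlim.eventually (gt_mem_nhds (sub_pos.2 hlt))] with k hk
      rw [hF]
      simp only
      rw [indicator_of_mem]
      exact ⟨htm.1, by linarith⟩
    exact hconv.liminf_eq.ge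
  calc _ ≤ _ := hle
    _ ≤ liminf (fun k => ∫⁻ t in Ioc 0 T, F k t) atTop := lintegral_liminf_le hFm
    _ ≤ c := liminf_le_of_frequently_le' (Frequently.of_forall hFint)

lemma aux_action_closed {d : ℕ} {T : ℝ} (hT : 0 < T) (r C : ℝ) (hr : 1 < r) (hC : 0 < C)
    (L : Euc d → ℝ) (hLconv : ConvexOn ℝ Set.univ L) (hLcont : Continuous L)
    (hLg : ∀ p : Euc d, ‖p‖ ^ r ≤ r * C * (L p + C))
    (hL0 : ∀ p, 0 ≤ L p + C) (γ : ℕ → Traj d T) (γ' : Traj d T)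
    (hγ : Tendsto γ atTop (𝓝 γ')) (A : ℝ) (hA : 0 < A)
    (hc : ∀ n, actionN L C (γ n) < ENNReal.ofReal A) :
    actionN L C γ' ≤ ENNReal.ofReal A := by
  apply aux_action_le_of_ac hT L hLcont C γ'
  · have hbd : ∀ K, 0 < K → ∀ E ∈ AbsolutelyContinuousOnInterval.disjWithin 0 T,
        ∑ i ∈ Finset.range E.1, dist (evalAt hT.le (E.2 i).1 γ') (evalAt hT.le (E.2 i).2 γ')
        ≤ K * ∑ i ∈ Finset.range E.1, dist (E.2 i).1 (E.2 i).2 + K ^ (1 - r) * (r * C) * A := by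
      intro K hK E hE
      have hlim : Tendsto (fun n => ∑ i ∈ Finset.range E.1,
          dist (evalAt hT.le (E.2 i).1 (γ n)) (evalAt hT.le (E.2 i).2 (γ n))) atTop
          (𝓝 (∑ i ∈ Finset.range E.1,
            dist (evalAt hT.le (E.2 i).1 γ') (evalAt hT.le (E.2 i).2 γ'))) := by
        refine tendsto_finsetSum _ fun i _ => ?_
        exact (((aux_continuous_eval' hT.le _).tendsto γ').comp hγ).dist
          (((aux_continuous_eval' hT.le _).tendsto γ').comp hγ)
      exact le_of_tendsto hlim (Eventually.of_forall fun n =>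
        aux_sum_bound hT r C hr hC L hLcont hLg hL0 (γ n) A hA (hc n) K hK E hE)
    rw [absolutelyContinuousOnInterval_iff]
    intro e he
    obtain ⟨K, hK, hKe⟩ := aux_rpow_small r (r * C * A) (e / 2) hr (by linarith)
    refine ⟨e / (2 * K), by positivity, fun E hE hl => ?_⟩
    have h1 := hbd K hK E hE
    have h2 : K * ∑ i ∈ Finset.range E.1, dist (E.2 i).1 (E.2 i).2 < e / 2 := by
      rw [lt_div_iff₀ (by positivity)] at hl
      linarith
    have h3 : K ^ (1 - r) * (r * C) * A = K ^ (1 - r) * (r * C * A) := by ring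
    linarith
  · intro h hh
    exact aux_phi_lsc hT.le L hLcont C h γ γ' hγ _ fun n =>
      aux_phi_le hT L hLconv hLcont C hL0 (γ n) _ (hc n) h hh

lemma aux_action_lsc {d : ℕ} {T : ℝ} (hT : 0 < T) (r C : ℝ) (hr : 1 < r) (hC : 0 < C)
    (L : Euc d → ℝ) (hLconv : ConvexOn ℝ Set.univ L) (hLcont : Continuous L)
    (hLg : ∀ p : Euc d, ‖p‖ ^ r ≤ r * C * (L p + C))
    (hL0 : ∀ p, 0 ≤ L p + C) :
    LowerSemicontinuous (fun γ : Traj d T => actionN L C γ) := by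
  intro γ' y hy
  by_contra hcon
  obtain ⟨c, hc1, hc2⟩ := exists_between hy
  have hctop : c ≠ ⊤ := ne_top_of_lt hc2
  have hc0 : 0 < c := lt_of_le_of_lt zero_le hc1
  rw [Filter.not_eventually] at hcon
  obtain ⟨u, hu, huc⟩ := exists_seq_forall_of_frequently hcon
  have hA : ENNReal.ofReal c.toReal = c := ENNReal.ofReal_toReal hctop
  have := aux_action_closed hT r C hr hC L hLconv hLcont hLg hL0 u γ' hu c.toReal
    (ENNReal.toReal_pos hc0.ne' hctop) (fun n => by
      rw [hA]; exact lt_of_le_of_lt (not_lt.1 (huc n)) hc1)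
  rw [hA] at this
  exact absurd hc2 (not_lt.2 this)

/-! ### Lower semicontinuity of the energy -/

lemma aux_eval_isProb {d : ℕ} {T : ℝ} (hT : 0 ≤ T) (Q : Measure (Traj d T))
    (hQ : IsProbabilityMeasure Q) (t : ℝ) : IsProbabilityMeasure (Q.map (evalAt hT t)) :=
  Measure.isProbabilityMeasure_map (aux_continuous_eval' hT t).measurable.aemeasurable

lemma aux_narrow_time {d : ℕ} {T : ℝ} (hT : 0 ≤ T) (Q : Measure (Traj d T))
    (hQ : IsProbabilityMeasure Q) (u : ℕ → ℝ) (t : ℝ) (hu : Tendsto u atTop (𝓝 t)) :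
    NarrowTendsto (fun n => Q.map (evalAt hT (u n))) (Q.map (evalAt hT t)) := by
  intro f
  have e : ∀ s : ℝ, ∫ y, f y ∂(Q.map (evalAt hT s)) = ∫ γ, f (evalAt hT s γ) ∂Q := by
    intro s
    exact integral_map (aux_continuous_eval' hT s).measurable.aemeasurable
      f.continuous.aestronglyMeasurable
  simp only [e]
  refine tendsto_integral_of_dominated_convergence (fun _ => ‖f‖) ?_ (integrable_const _) ?_ ?_
  · intro n
    exact (f.continuous.measurable.comp
      (aux_continuous_eval' hT (u n)).measurable).aestronglyMeasurable
  · intro n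
    exact Eventually.of_forall fun γ => f.norm_coe_le_norm _
  · refine Eventually.of_forall fun γ => ?_
    exact ((f.continuous.comp (aux_continuous_eval hT γ)).tendsto t).comp hu

lemma aux_moreau_meas {d : ℕ} {T : ℝ} (hT : 0 ≤ T) (Ω : Set (Euc d)) (hΩc : IsCompact Ω)
    (F : Measure (Euc d) → ℝ≥0∞)
    (hFlsc : ∀ (ρ : ℕ → Measure (Euc d)) (σ : Measure (Euc d)),
      (∀ n, IsFiniteMeasure (ρ n)) → IsFiniteMeasure σ → NarrowTendsto ρ σ →
      F σ ≤ liminf (fun n => F (ρ n)) atTop)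
    (ε : ℝ) (hε : 0 < ε) (Q : Measure (Traj d T)) (hQ : IsProbabilityMeasure Q) :
    Measurable (fun t => moreau Ω F ε (Q.map (evalAt hT t))) := by
  apply LowerSemicontinuous.measurable
  intro t y hy
  by_contra hcon
  rw [Filter.not_eventually] at hcon
  obtain ⟨u, hu, huc⟩ := exists_seq_forall_of_frequently hcon
  have h1 := aux_moreau_lsc Ω hΩc F hFlsc ε hε _ _
    (fun n => aux_eval_isProb hT Q hQ (u n)) (aux_eval_isProb hT Q hQ t)
    (aux_narrow_time hT Q hQ u t hu)
  have h2 : liminf (fun n => moreau Ω F ε (Q.map (evalAt hT (u n)))) atTop ≤ y :=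
    liminf_le_of_frequently_le' (Frequently.of_forall fun n => not_lt.1 (huc n))
  exact absurd hy (not_lt.2 (h1.trans h2))

lemma aux_J_eq {d : ℕ} {T : ℝ} (hT : 0 ≤ T) (Ω : Set (Euc d)) (L : Euc d → ℝ) (C : ℝ)
    (F : Measure (Euc d) → ℝ≥0∞) (G : Measure (Traj d T) → ℝ) (ε : ℝ)
    (Q : Measure (Traj d T)) :
    Jeps hT Ω L C F G ε Q = (((∫⁻ γ, actionN L C γ ∂Q)
      + ∫⁻ t in Set.Ioc (0:ℝ) T, moreau Ω F ε (Q.map (evalAt hT t)) : ℝ≥0∞) : EReal)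
      + ((G Q - C * T : ℝ) : EReal) := by
  unfold Jeps kinE
  rw [EReal.coe_ennreal_add, EReal.coe_sub, sub_eq_add_neg, sub_eq_add_neg]
  ac_rfl

lemma aux_J_lsc {d : ℕ} {T : ℝ} (hT : 0 < T) (Ω : Set (Euc d)) (hΩc : IsCompact Ω)
    (r C : ℝ) (hr : 1 < r) (hC : 0 < C)
    (L : Euc d → ℝ) (hLconv : ConvexOn ℝ Set.univ L) (hLcont : Continuous L)
    (hLg : ∀ p : Euc d, ‖p‖ ^ r ≤ r * C * (L p + C))
    (hL0 : ∀ p, 0 ≤ L p + C)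
    (F : Measure (Euc d) → ℝ≥0∞)
    (hFlsc : ∀ (ρ : ℕ → Measure (Euc d)) (σ : Measure (Euc d)),
      (∀ n, IsFiniteMeasure (ρ n)) → IsFiniteMeasure σ → NarrowTendsto ρ σ →
      F σ ≤ liminf (fun n => F (ρ n)) atTop)
    (G : Measure (Traj d T) → ℝ)
    (hGcont : ∀ (Q : ℕ → Measure (Traj d T)) (Q' : Measure (Traj d T)),
      (∀ n, IsProbabilityMeasure (Q n)) → IsProbabilityMeasure Q' →
      NarrowTendsto Q Q' → Tendsto (fun n => G (Q n)) atTop (𝓝 (G Q')))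
    (ε : ℝ) (hε : 0 < ε)
    (Q : ℕ → Measure (Traj d T)) (Qlim : Measure (Traj d T))
    (hQ : ∀ n, IsProbabilityMeasure (Q n)) (hQl : IsProbabilityMeasure Qlim)
    (hnar : NarrowTendsto Q Qlim) :
    Jeps hT.le Ω L C F G ε Qlim ≤ liminf (fun n => Jeps hT.le Ω L C F G ε (Q n)) atTop := by
  have hA : ∫⁻ γ, actionN L C γ ∂Qlim ≤ liminf (fun n => ∫⁻ γ, actionN L C γ ∂(Q n)) atTop :=
    aux_lintegral_lsc (aux_action_lsc hT r C hr hC L hLconv hLcont hLg hL0)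
      (aux_narrow_open hQ hQl hnar)
  have hB : ∫⁻ t in Set.Ioc (0:ℝ) T, moreau Ω F ε (Qlim.map (evalAt hT.le t))
      ≤ liminf (fun n => ∫⁻ t in Set.Ioc (0:ℝ) T,
          moreau Ω F ε ((Q n).map (evalAt hT.le t))) atTop := by
    calc _ ≤ ∫⁻ t in Set.Ioc (0:ℝ) T,
          liminf (fun n => moreau Ω F ε ((Q n).map (evalAt hT.le t))) atTop := by
          refine lintegral_mono fun t => ?_
          exact aux_moreau_lsc Ω hΩc F hFlsc ε hε _ _
            (fun n => aux_eval_isProb hT.le (Q n) (hQ n) t) (aux_eval_isProb hT.le Qlim hQl t)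
            (aux_narrow_map hnar (aux_continuous_eval' hT.le t))
      _ ≤ _ := lintegral_liminf_le fun n =>
          aux_moreau_meas hT.le Ω hΩc F hFlsc ε hε (Q n) (hQ n)
  have hAB := (add_le_add hA hB).trans (aux_ennreal_liminf_add _ _)
  have hG : Tendsto (fun n => ((G (Q n) - C * T : ℝ) : EReal)) atTop
      (𝓝 ((G Qlim - C * T : ℝ) : EReal)) :=
    (continuous_coe_real_ereal.tendsto _).comp ((hGcont Q Qlim hQ hQl hnar).sub_const (C * T))
  simp only [aux_J_eq]
  refine le_trans ?_ (EReal.le_liminf_add)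
  rw [hG.liminf_eq]
  refine add_le_add ?_ le_rfl
  refine (EReal.coe_ennreal_le_coe_ennreal_iff.2 hAB).trans (le_of_eq ?_)
  exact Monotone.map_liminf_of_continuousAt (fun a b h => EReal.coe_ennreal_le_coe_ennreal_iff.2 h) _
    continuous_coe_ennreal_ereal.continuousAt

/-! ### Compactness of sublevels of the action -/

lemma aux_compact {d : ℕ} {T : ℝ} (hT : 0 < T) (Ω : Set (Euc d)) (hΩc : IsCompact Ω)
    (r C : ℝ) (hr : 1 < r) (hC : 0 < C)
    (L : Euc d → ℝ) (hLcont : Continuous L)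
    (hLg : ∀ p : Euc d, ‖p‖ ^ r ≤ r * C * (L p + C))
    (hL0 : ∀ p, 0 ≤ L p + C) (A : ℝ) (hA : 0 < A) :
    ∃ K : Set (Traj d T), IsCompact K ∧
      ∀ γ : Traj d T, evalAt hT.le 0 γ ∈ Ω → actionN L C γ < ENNReal.ofReal A → γ ∈ K := by
  set S : Set (Traj d T) := {γ | evalAt hT.le 0 γ ∈ Ω ∧ actionN L C γ < ENNReal.ofReal A} with hS
  have hmod : ∀ γ ∈ S, ∀ K, 0 < K → ∀ s t : Icc (0:ℝ) T, dist (γ s) (γ t)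
      ≤ K * dist s t + K ^ (1 - r) * (r * C * A) := by
    intro γ hγ K hK s t
    have := aux_sum_bound hT r C hr hC L hLcont hLg hL0 γ A hA hγ.2 K hK
      (1, fun _ => ((s:ℝ), (t:ℝ))) (by
        refine ⟨fun i _ => ?_, ?_⟩
        · rw [uIcc_of_le hT.le]; exact ⟨s.2, t.2⟩
        · simp)
    simp only [Finset.range_one, Finset.sum_singleton, evalAt, projIcc_val] at this
    rw [Subtype.dist_eq, ← mul_assoc]
    exact this
  obtain ⟨R, hR⟩ := hΩc.isBounded.subset_closedBall (0 : Euc d)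
  let e := ContinuousMap.isometryEquivBoundedOfCompact (Icc (0:ℝ) T) (Euc d)
  have hcomp : IsCompact (closure (e '' S)) := by
    refine BoundedContinuousFunction.arzela_ascoli
      (Metric.closedBall (0 : Euc d) (R + (T + r * C * A))) (isCompact_closedBall _ _) _ ?_ ?_
    · rintro _ t ⟨γ, hγ, rfl⟩
      show γ t ∈ _
      have h1 := hmod γ hγ 1 one_pos ⟨0, le_rfl, hT.le⟩ t
      have h2 : γ ⟨0, le_rfl, hT.le⟩ ∈ Metric.closedBall (0 : Euc d) R := by
        have := hR hγ.1
        unfold evalAt at this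
        rwa [projIcc_of_mem hT.le (⟨le_rfl, hT.le⟩ : (0:ℝ) ∈ Icc 0 T)] at this
      rw [Metric.mem_closedBall] at h2 ⊢
      have h3 : dist (⟨0, le_rfl, hT.le⟩ : Icc (0:ℝ) T) t ≤ T := by
        rw [Subtype.dist_eq, dist_comm, Real.dist_eq, sub_zero, abs_of_nonneg t.2.1]
        exact t.2.2
      rw [Real.one_rpow] at h1
      have h4 := dist_triangle_left (γ t) 0 (γ ⟨0, le_rfl, hT.le⟩)
      linarith
    · apply UniformEquicontinuous.equicontinuous
      rw [Metric.uniformEquicontinuous_iff]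
      intro η hη
      obtain ⟨K, hK, hK2⟩ := aux_rpow_small r (r * C * A) (η / 2) hr (half_pos hη)
      refine ⟨η / 2 / K, by positivity, ?_⟩
      rintro s t hst ⟨_, γ, hγ, rfl⟩
      have h1 := hmod γ hγ K hK s t
      have h2 : K * dist s t < η / 2 := by
        rw [lt_div_iff₀ hK] at hst
        linarith
      show dist (γ s) (γ t) < η
      linarith
  refine ⟨e.symm '' closure (e '' S), hcomp.image e.symm.continuous, fun γ h1 h2 => ?_⟩
  exact ⟨e γ, subset_closure ⟨γ, ⟨h1, h2⟩, rfl⟩, e.symm_apply_apply γ⟩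

/-! ### Discrete measures -/

lemma aux_disc_prob {X : Type*} [MeasurableSpace X] (N : ℕ) (hN : 0 < N) (x : Fin N → X) :
    IsProbabilityMeasure (((N : ℝ≥0∞))⁻¹ • ∑ i, Measure.dirac (x i)) := by
  constructor
  simp only [Measure.smul_apply, Measure.finsetSum_apply, measure_univ, Finset.sum_const,
    Finset.card_univ, Fintype.card_fin, smul_eq_mul, nsmul_eq_mul, mul_one]
  exact ENNReal.inv_mul_cancel (by exact_mod_cast hN.ne') (ENNReal.natCast_ne_top N)

lemma aux_disc_map {X Y : Type*} [MeasurableSpace X] [MeasurableSpace Y] (N : ℕ)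
    (x : Fin N → X) (f : X → Y) (hf : Measurable f) :
    (((N : ℝ≥0∞))⁻¹ • ∑ i, Measure.dirac (x i)).map f
      = ((N : ℝ≥0∞))⁻¹ • ∑ i, Measure.dirac (f (x i)) := by
  ext s hs
  rw [Measure.map_apply hf hs]
  simp only [Measure.smul_apply, Measure.finsetSum_apply, Measure.dirac_apply' _ hs,
    Measure.dirac_apply' _ (hf hs)]
  rfl

lemma aux_disc_lintegral {X : Type*} [MeasurableSpace X] (N : ℕ)
    (x : Fin N → X) (f : X → ℝ≥0∞) (hf : Measurable f) :
    ∫⁻ y, f y ∂(((N : ℝ≥0∞))⁻¹ • ∑ i, Measure.dirac (x i))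
      = ((N : ℝ≥0∞))⁻¹ * ∑ i, f (x i) := by
  rw [lintegral_smul_measure, lintegral_finsetSum_measure]
  simp only [lintegral_dirac' _ hf, smul_eq_mul]

lemma aux_disc_narrow {X : Type*} [TopologicalSpace X] [MeasurableSpace X] [BorelSpace X]
    (N : ℕ) (x : ℕ → Fin N → X) (y : Fin N → X) (h : Tendsto x atTop (𝓝 y)) :
    NarrowTendsto (fun n => ((N : ℝ≥0∞))⁻¹ • ∑ i, Measure.dirac (x n i))
      (((N : ℝ≥0∞))⁻¹ • ∑ i, Measure.dirac (y i)) := by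
  intro f
  have e : ∀ z : Fin N → X, ∫ w, f w ∂(((N : ℝ≥0∞))⁻¹ • ∑ i, Measure.dirac (z i))
      = (((N : ℝ≥0∞))⁻¹).toReal • ∑ i, f (z i) := by
    intro z
    rw [integral_smul_measure, integral_finsetSum_measure]
    · simp only [integral_dirac' _ _ f.continuous.measurable.stronglyMeasurable]
    · intro i _
      exact f.integrable _
  simp only [e]
  refine Tendsto.const_smul ?_ _
  refine tendsto_finsetSum _ fun i _ => ?_
  exact (f.continuous.tendsto _).comp ((tendsto_pi_nhds.1 h) i)

lemma aux_disc_null {X : Type*} [MeasurableSpace X] (N : ℕ)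
    (x : Fin N → X) (s : Set X) (hs : MeasurableSet s)
    (h : (((N : ℝ≥0∞))⁻¹ • ∑ i, Measure.dirac (x i)) sᶜ = 0) (i : Fin N) : x i ∈ s := by
  simp only [Measure.smul_apply, Measure.finsetSum_apply, smul_eq_mul, mul_eq_zero,
    ENNReal.inv_eq_zero, ENNReal.natCast_ne_top, false_or, Finset.sum_eq_zero_iff] at h
  have := h i (Finset.mem_univ _)
  rw [Measure.dirac_apply' _ hs.compl] at this
  by_contra hcon
  rw [indicator_of_mem (show x i ∈ sᶜ from hcon)] at this
  simp at this

/-! ### Main theorem -/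

/-- For every `N ∈ ℕ*`, `ε > 0` and `μ⁰_N ∈ P_N(Ω)`, the regularized
functional `J_ε` is narrowly lower semi-continuous on `P(Γ)` and the infimum in the
discretized problem `(M_{N,μ⁰_N,ε}) : inf { J_ε(Q) : Q ∈ P_N(Γ), e₀#Q = μ⁰_N }`
is attained. -/
theorem lsc_and_existence_discrete
    (d : ℕ) (T : ℝ) (hT : 0 < T)
    (Ω : Set (Euc d)) (hΩc : IsCompact Ω) (hΩmeas : MeasurableSet Ω) (hΩne : Ω.Nonempty)
    (r C : ℝ) (hr : 1 < r) (hC : 0 < C)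
    (L : Euc d → ℝ) (hLconv : ConvexOn ℝ Set.univ L) (hLcont : Continuous L)
    (hLgrow : ∀ p : Euc d, 1 / (r * C) * ‖p‖ ^ r - C ≤ L p ∧ L p ≤ C / r * ‖p‖ ^ r + C)
    (F : Measure (Euc d) → ℝ≥0∞)
    (hFconv : ∀ ρ σ : Measure (Euc d), ∀ a b : ℝ≥0∞, a + b = 1 →
      F (a • ρ + b • σ) ≤ a * F ρ + b * F σ)
    (hFlsc : ∀ (ρ : ℕ → Measure (Euc d)) (σ : Measure (Euc d)),
      (∀ n, IsFiniteMeasure (ρ n)) → IsFiniteMeasure σ → NarrowTendsto ρ σ →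
      F σ ≤ liminf (fun n => F (ρ n)) atTop)
    (hFsupp : ∀ ρ : Measure (Euc d), F ρ ≠ ⊤ → ρ Ωᶜ = 0)
    (G : Measure (Traj d T) → ℝ)
    (hGconv : ∀ Q Q' : Measure (Traj d T), ∀ a : ℝ, a ∈ Set.Icc (0:ℝ) 1 →
      G (ENNReal.ofReal a • Q + ENNReal.ofReal (1 - a) • Q') ≤ a * G Q + (1 - a) * G Q')
    (hGcont : ∀ (Q : ℕ → Measure (Traj d T)) (Q' : Measure (Traj d T)),
      (∀ n, IsProbabilityMeasure (Q n)) → IsProbabilityMeasure Q' →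
      NarrowTendsto Q Q' → Tendsto (fun n => G (Q n)) atTop (𝓝 (G Q')))
    (hGbdd : BddBelow (Set.range G))
    (N : ℕ) (hN : 0 < N) (ε : ℝ) (hε : 0 < ε)
    (μ0N : Measure (Euc d)) (hμ0N : IsUnifDiscrete N μ0N) (hμ0NΩ : μ0N Ωᶜ = 0) :
    (∀ (Q : ℕ → Measure (Traj d T)) (Qlim : Measure (Traj d T)),
        (∀ n, IsProbabilityMeasure (Q n)) → IsProbabilityMeasure Qlim →
        NarrowTendsto Q Qlim →
        Jeps hT.le Ω L C F G ε Qlim ≤ liminf (fun n => Jeps hT.le Ω L C F G ε (Q n)) atTop)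
    ∧ ∃ Qm : Measure (Traj d T), IsUnifDiscrete N Qm ∧
        Qm.map (evalAt hT.le 0) = μ0N ∧
        ∀ Q : Measure (Traj d T), IsUnifDiscrete N Q → Q.map (evalAt hT.le 0) = μ0N →
          Jeps hT.le Ω L C F G ε Qm ≤ Jeps hT.le Ω L C F G ε Q := by
  have hrC : 0 < r * C := by positivity
  have hLg : ∀ p : Euc d, ‖p‖ ^ r ≤ r * C * (L p + C) := by
    intro p
    have h := (hLgrow p).1
    have h2 : 1 / (r * C) * ‖p‖ ^ r ≤ L p + C := by linarith
    rw [one_div, inv_mul_le_iff₀ hrC] at h2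
    exact h2
  have hL0 : ∀ p, 0 ≤ L p + C := by
    intro p
    have h := (hLgrow p).1
    have h2 : 0 ≤ 1 / (r * C) * ‖p‖ ^ r := by positivity
    linarith
  have hlsc := aux_J_lsc hT Ω hΩc r C hr hC L hLconv hLcont hLg hL0 F hFlsc G hGcont ε hε
  refine ⟨hlsc, ?_⟩
  have hact := aux_action_lsc hT r C hr hC L hLconv hLcont hLg hL0
  have hem := (aux_continuous_eval' (d := d) hT.le 0).measurable
  obtain ⟨y, hy⟩ := hμ0N
  set J := Jeps hT.le Ω L C F G ε with hJ
  set feas : Set (Measure (Traj d T)) :=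
    {Q | IsUnifDiscrete N Q ∧ Q.map (evalAt hT.le 0) = μ0N} with hfeas
  let Q0 : Measure (Traj d T) :=
    ((N : ℝ≥0∞))⁻¹ • ∑ i, Measure.dirac (ContinuousMap.const (Icc (0:ℝ) T) (y i))
  have hQ0 : Q0 ∈ feas := by
    refine ⟨⟨_, rfl⟩, ?_⟩
    rw [aux_disc_map N _ _ hem, hy]
    rfl
  have hle : ∀ Q, IsUnifDiscrete N Q → Q.map (evalAt hT.le 0) = μ0N → sInf (J '' feas) ≤ J Q :=
    fun Q h1 h2 => sInf_le ⟨Q, ⟨h1, h2⟩, rfl⟩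
  by_cases hm : sInf (J '' feas) = ⊤
  · refine ⟨Q0, hQ0.1, hQ0.2, fun Q h1 h2 => ?_⟩
    have := hle Q h1 h2
    rw [hm, top_le_iff] at this
    rw [this]
    exact le_top
  obtain ⟨u, -, hut, hu⟩ := exists_seq_tendsto_sInf (S := J '' feas) ⟨_, Q0, hQ0, rfl⟩
    (OrderBot.bddBelow _)
  obtain ⟨M, hM, -⟩ := EReal.lt_iff_exists_real_btwn.1 (lt_top_iff_ne_top.2 hm)
  obtain ⟨n0, hn0⟩ := eventually_atTop.1 (hut.eventually (gt_mem_nhds hM))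
  choose Q hQf hQu using hu
  choose x hx using fun n => (hQf n).1
  obtain ⟨b, hb⟩ := hGbdd
  have hb' : ∀ P, b ≤ G P := fun P => hb ⟨P, rfl⟩
  set D : ℝ := max (M + C * T - b) 1 with hD
  have hD0 : 0 < D := lt_of_lt_of_le one_pos (le_max_right _ _)
  have hN' : (0 : ℝ) < N := by exact_mod_cast hN
  have hbound : ∀ n, n0 ≤ n → ∫⁻ γ, actionN L C γ ∂(Q n) < ENNReal.ofReal D := by
    intro n hn
    by_contra hcon
    push Not at hcon
    have h1 := hn0 n hn
    rw [← hQu n, hJ, aux_J_eq] at h1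
    refine absurd h1 (not_lt.2 ?_)
    have h2 : (M : EReal) ≤ ((ENNReal.ofReal D : ℝ≥0∞) : EReal) + ((G (Q n) - C * T : ℝ) : EReal) := by
      rw [EReal.coe_ennreal_ofReal, max_eq_left hD0.le, ← EReal.coe_add, EReal.coe_le_coe_iff]
      have := hb' (Q n)
      have := le_max_left (M + C * T - b) 1
      linarith
    refine h2.trans (add_le_add ?_ le_rfl)
    exact EReal.coe_ennreal_le_coe_ennreal_iff.2 (hcon.trans le_self_add)
  obtain ⟨K, hK, hKmem⟩ := aux_compact hT Ω hΩc r C hr hC L hLcont hLg hL0 (N * D) (by positivity)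
  have hxK : ∀ n, n0 ≤ n → ∀ i, x n i ∈ K := by
    intro n hn i
    refine hKmem _ ?_ ?_
    · have h1 := (hQf n).2
      rw [hx n, aux_disc_map N _ _ hem] at h1
      refine aux_disc_null N (fun i => evalAt hT.le 0 (x n i)) Ω hΩmeas ?_ i
      rw [h1]
      exact hμ0NΩ
    · have h1 := hbound n hn
      rw [hx n, aux_disc_lintegral N _ _ hact.measurable] at h1
      rw [ENNReal.ofReal_mul hN'.le, ENNReal.ofReal_natCast]
      refine lt_of_le_of_lt (Finset.single_le_sum (f := fun i => actionN L C (x n i))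
        (fun _ _ => zero_le) (Finset.mem_univ i)) ?_
      by_contra hcon
      push Not at hcon
      refine absurd h1 (not_lt.2 ?_)
      rw [← ENNReal.mul_le_mul_iff_right (a := (N : ℝ≥0∞)) (by exact_mod_cast hN.ne')
        (ENNReal.natCast_ne_top N), ← mul_assoc,
        ENNReal.mul_inv_cancel (by exact_mod_cast hN.ne') (ENNReal.natCast_ne_top N), one_mul]
      exact hcon
  have hKpi : IsCompact (Set.pi univ (fun _ : Fin N => K)) := isCompact_univ_pi fun _ => hK
  obtain ⟨z, -, φ, hφ, hz⟩ := hKpi.tendsto_subseq (x := fun n => x (n + n0))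
    (fun n i _ => hxK _ (Nat.le_add_left _ _) i)
  let ψ : ℕ → ℕ := fun n => φ n + n0
  let Qz : Measure (Traj d T) := ((N : ℝ≥0∞))⁻¹ • ∑ i, Measure.dirac (z i)
  have hnar : NarrowTendsto (fun n => Q (ψ n)) Qz := by
    have h := aux_disc_narrow N (fun n => x (ψ n)) z hz
    have e : (fun n => Q (ψ n)) = fun n => ((N : ℝ≥0∞))⁻¹ • ∑ i, Measure.dirac (x (ψ n) i) :=
      funext fun n => hx _
    rw [e]
    exact h
  have hprob : ∀ n, IsProbabilityMeasure (Q (ψ n)) := fun n => by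
    rw [hx]
    exact aux_disc_prob N hN _
  have hprobz : IsProbabilityMeasure Qz := aux_disc_prob N hN z
  have hzf : Qz.map (evalAt hT.le 0) = μ0N := by
    have h1 := aux_narrow_map hnar (aux_continuous_eval' hT.le 0)
    simp only [fun n => (hQf (ψ n)).2] at h1
    have := aux_eval_isProb hT.le Qz hprobz 0
    have : IsProbabilityMeasure μ0N := by rw [hy]; exact aux_disc_prob N hN y
    refine aux_narrow_unique h1 ?_
    intro f
    exact tendsto_const_nhds
  refine ⟨Qz, ⟨z, rfl⟩, hzf, fun P h1 h2 => ?_⟩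
  refine le_trans ?_ (hle P h1 h2)
  refine (hlsc _ _ hprob hprobz hnar).trans (le_of_eq ?_)
  have hψ : Tendsto ψ atTop atTop := 
    tendsto_atTop_mono (fun n => Nat.le_add_right (φ n) n0) hφ.tendsto_atTop
  have h3 : Tendsto (fun n => J (Q (ψ n))) atTop (𝓝 (sInf (J '' feas))) := by
    simp only [hQu]
    exact hut.comp hψ
  exact h3.liminf_eq
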